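/- arXiv:1902.06402 — 2 statements merged into one kernel-verified Lean document; each statement's English description precedes it below -/
import Mathlib

section
/- Let G be a 3-connected cubic graph and let D be a finite subgraph of G each of whose components is either an isolated vertex or a 2-connected bipartite graph. Then G has a finite 2-connected bipartite subgraph F with D ≤ F (D a subgraph of F). -/
namespace IGraph

open SimpleGraph

universe u w

variable {V : Type u} {W : Type w}

/-- `G` is locally finite: every vertex has finite degree. -/
def LocFin (G : SimpleGraph V) : Prop := ∀ v : V, (G.neighborSet v).Finite

/-- A ray of `G`: a one-way infinite path, given by an injective sequence of
successively adjacent vertices. -/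
def IsRay (G : SimpleGraph V) (R : ℕ → V) : Prop :=
  Function.Injective R ∧ ∀ n : ℕ, G.Adj (R n) (R (n + 1))

/-- `G − S`, kept on the same vertex type (removed vertices become isolated). -/
def del (G : SimpleGraph V) (S : Set V) : SimpleGraph V where
  Adj a b := G.Adj a b ∧ a ∉ S ∧ b ∉ S
  symm := ⟨fun a b h => ⟨h.1.symm, h.2.2, h.2.1⟩⟩
  loopless := ⟨fun a h => G.loopless.irrefl a h.1⟩

/-- Two rays are equivalent in `G` if for every finite `S ⊆ V(G)` some component of
`G − S` contains a tail of both. -/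
def RayEquiv (G : SimpleGraph V) (R₁ R₂ : ℕ → V) : Prop :=
  ∀ S : Set V, S.Finite →
    ∃ m n : ℕ, (∀ i, m ≤ i → R₁ i ∉ S) ∧ (∀ j, n ≤ j → R₂ j ∉ S) ∧
      (del G S).Reachable (R₁ m) (R₂ n)

/-- `F` is a faithful subgraph of `G` (both presented on the same vertex type):
(1) every end of `G` contains a ray of `F`, and (2) two rays of `F` are equivalent in `F`
iff they are equivalent in `G`. -/
def Faithful (F G : SimpleGraph V) : Prop :=
  (∀ R : ℕ → V, IsRay G R → ∃ R' : ℕ → V, IsRay F R' ∧ RayEquiv G R R') ∧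
  ∀ R₁ R₂ : ℕ → V, IsRay F R₁ → IsRay F R₂ → (RayEquiv F R₁ R₂ ↔ RayEquiv G R₁ R₂)

/-- `N_G(X)`: vertices outside `X` with a neighbor in `X`. -/
def NSet (G : SimpleGraph V) (X : Set V) : Set V := {y | y ∉ X ∧ ∃ x ∈ X, G.Adj x y}

/-- `Z_G(X)`: vertices of `X` with a neighbor outside `X`. -/
def ZSet (G : SimpleGraph V) (X : Set V) : Set V := {x | x ∈ X ∧ ∃ y, y ∉ X ∧ G.Adj x y}

/-- The vertex set of the component of `G − S` containing `v`. -/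
def compOf (G : SimpleGraph V) (S : Set V) (v : V) : Set V := {x | (del G S).Reachable v x}

/-- The degree of the end of `G` represented by the ray `R`: the supremum of the numbers of
pairwise vertex-disjoint rays equivalent to `R`. -/
noncomputable def endDegree (G : SimpleGraph V) (R : ℕ → V) : ℕ∞ :=
  ⨆ n ∈ {n : ℕ | ∃ f : Fin n → ℕ → V,
      (∀ i, IsRay G (f i) ∧ RayEquiv G (f i) R) ∧
      ∀ i j, i ≠ j → Disjoint (Set.range (f i)) (Set.range (f j))}, (n : ℕ∞)

/-- `H` is `k`-connected: `|V(H)| > k` and removing fewer than `k` vertices leaves a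
connected graph. -/
def IsKConn (k : ℕ) (H : SimpleGraph W) : Prop :=
  (k : Cardinal) < Cardinal.mk W ∧
    ∀ X : Set W, X.Finite → X.ncard < k → (H.induce Xᶜ).Connected

/-- Every vertex has degree at most 3. -/
def Subcubic (G : SimpleGraph V) : Prop :=
  ∀ v : V, (G.neighborSet v).Finite ∧ (G.neighborSet v).ncard ≤ 3

/-- Every vertex has degree exactly 3. -/
def Cubic (G : SimpleGraph V) : Prop := ∀ v : V, (G.neighborSet v).ncard = 3

/-- `S` is 3-connected in `G`: every two vertices of `S` are joined by three pairwise
internally disjoint paths of `G`. -/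
def ThreeConnIn (G : SimpleGraph V) (S : Set V) : Prop :=
  ∀ u v : V, u ∈ S → v ∈ S → u ≠ v →
    ∃ p₁ p₂ p₃ : G.Path u v,
      p₁ ≠ p₂ ∧ p₁ ≠ p₃ ∧ p₂ ≠ p₃ ∧
      (∀ x, x ∈ (p₁ : G.Walk u v).support → x ∈ (p₂ : G.Walk u v).support → x = u ∨ x = v) ∧
      (∀ x, x ∈ (p₁ : G.Walk u v).support → x ∈ (p₃ : G.Walk u v).support → x = u ∨ x = v) ∧
      (∀ x, x ∈ (p₂ : G.Walk u v).support → x ∈ (p₃ : G.Walk u v).support → x = u ∨ x = v)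

/-- A subgraph which is a (finite) cycle: finite, nonempty, connected and 2-regular. -/
def IsCycleSub {G : SimpleGraph W} (C : G.Subgraph) : Prop :=
  C.verts.Finite ∧ C.verts.Nonempty ∧ C.Connected ∧
    ∀ v ∈ C.verts, (C.neighborSet v).ncard = 2

/-- A cactus: a connected subcubic graph whose cycles are pairwise vertex-disjoint and whose
edges decompose into vertex-disjoint cycles and vertex-disjoint paths (equivalently, every
vertex on no cycle has degree at most 2). -/
def IsCactus (H : SimpleGraph W) : Prop :=
  H.Connected ∧ Subcubic H ∧
  (∀ C₁ C₂ : H.Subgraph, IsCycleSub C₁ → IsCycleSub C₂ → C₁ ≠ C₂ →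
    Disjoint C₁.verts C₂.verts) ∧
  ∀ v : W, (∀ C : H.Subgraph, IsCycleSub C → v ∉ C.verts) → (H.neighborSet v).ncard ≤ 2

/-- A semi-cactus: connected, maximum degree at most 4, every block is a cycle or a `K₂`
(equivalently, distinct cycles are edge-disjoint), and every vertex lies in at most two
blocks (cycles through `v` together with bridges at `v` number at most 2). -/
def IsSemiCactus (H : SimpleGraph W) : Prop :=
  H.Connected ∧ (∀ v : W, (H.neighborSet v).Finite ∧ (H.neighborSet v).ncard ≤ 4) ∧
  (∀ C₁ C₂ : H.Subgraph, IsCycleSub C₁ → IsCycleSub C₂ → C₁ ≠ C₂ →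
    Disjoint C₁.edgeSet C₂.edgeSet) ∧
  ∀ v : W,
    {C : H.Subgraph | IsCycleSub C ∧ v ∈ C.verts}.encard +
      {e : Sym2 W | e ∈ H.edgeSet ∧ v ∈ e ∧
        ∀ C : H.Subgraph, IsCycleSub C → e ∉ C.edgeSet}.encard ≤ 2

/-- Every cycle of `H` is even. -/
def EvenCycles (H : SimpleGraph W) : Prop :=
  ∀ C : H.Subgraph, IsCycleSub C → Even C.verts.ncard

/-- `v` is a cut-vertex of `H`: removing `v` separates two vertices. -/
def IsCutVert (H : SimpleGraph W) (v : W) : Prop :=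
  ∃ a b : W, a ≠ v ∧ b ≠ v ∧ H.Reachable a b ∧ ¬ (del H {v}).Reachable a b

/-- `H` is non-separable: connected without cut-vertices. -/
def Nonseparable (H : SimpleGraph W) : Prop := H.Connected ∧ ∀ v : W, ¬ IsCutVert H v

/-- `B` is the vertex set of a block of `H`: a maximal set inducing a non-separable graph. -/
def IsBlockSet (H : SimpleGraph W) (B : Set W) : Prop :=
  Nonseparable (H.induce B) ∧ ∀ B' : Set W, B ⊆ B' → Nonseparable (H.induce B') → B' = B

/-- An end-block: a block containing at most one cut-vertex of `H`. -/
def IsEndBlock (H : SimpleGraph W) (B : Set W) : Prop :=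
  IsBlockSet H B ∧ {v ∈ B | IsCutVert H v}.encard ≤ 1

/-- A block-chain: a connected graph whose block-cut tree is a path, i.e. every block
contains at most two cut-vertices and every cut-vertex lies in at most two blocks. -/
def IsBlockChain (H : SimpleGraph W) : Prop :=
  H.Connected ∧
  (∀ B : Set W, IsBlockSet H B → {v ∈ B | IsCutVert H v}.encard ≤ 2) ∧
  ∀ v : W, IsCutVert H v → {B : Set W | IsBlockSet H B ∧ v ∈ B}.encard ≤ 2

/-- A block-chain connecting `u` and `v`: either `H` is non-separable, or `H` is separable
and `u`, `v` are non-cut vertices of two distinct end-blocks. -/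
def BlockChainConn (H : SimpleGraph W) (u v : W) : Prop :=
  IsBlockChain H ∧
  (Nonseparable H ∨
    ((∃ x, IsCutVert H x) ∧
      ∃ B₁ B₂ : Set W, IsEndBlock H B₁ ∧ IsEndBlock H B₂ ∧ B₁ ≠ B₂ ∧
        u ∈ B₁ ∧ v ∈ B₂ ∧ ¬ IsCutVert H u ∧ ¬ IsCutVert H v))

/-- The `k`-th power of `G`: vertices at distance at most `k` become adjacent. -/
def gpow (G : SimpleGraph V) (k : ℕ) : SimpleGraph V where
  Adj u v := u ≠ v ∧ ∃ p : G.Walk u v, p.length ≤ k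
  symm := ⟨fun u v h => ⟨h.1.symm, by obtain ⟨p, hp⟩ := h.2; exact ⟨p.reverse, by simpa using hp⟩⟩⟩
  loopless := ⟨fun v h => h.1 rfl⟩

/-- The copy `G × {d₀}` of `G` inside the Cartesian product `G □ D`. -/
def copyAt (G : SimpleGraph V) (d₀ : W) : SimpleGraph (V × W) where
  Adj p q := G.Adj p.1 q.1 ∧ p.2 = d₀ ∧ q.2 = d₀
  symm := ⟨fun p q h => ⟨h.1.symm, h.2.2, h.2.1⟩⟩
  loopless := ⟨fun p h => G.loopless.irrefl _ h.1⟩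

/-- The line graph of the subgraph `F` of `G`, presented on the vertex set `E(G)` of the
line graph of `G` (edges of `G` not in `F` are isolated). -/
def lineSub (G F : SimpleGraph V) : SimpleGraph G.edgeSet where
  Adj e f := (e : Sym2 V) ∈ F.edgeSet ∧ (f : Sym2 V) ∈ F.edgeSet ∧ e ≠ f ∧
    ∃ x : V, x ∈ (e : Sym2 V) ∧ x ∈ (f : Sym2 V)
  symm := ⟨fun e f h =>
    ⟨h.2.1, h.1, h.2.2.1.symm, by obtain ⟨x, h1, h2⟩ := h.2.2.2; exact ⟨x, h2, h1⟩⟩⟩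
  loopless := ⟨fun e h => h.2.2.1 rfl⟩

/-- `B ⊆ V(G)` induces a cycle of `G`. -/
def IsCycleSet (G : SimpleGraph V) (B : Set V) : Prop :=
  B.Finite ∧ B.Nonempty ∧ (G.induce B).Connected ∧
    ∀ v ∈ B, (G.neighborSet v ∩ B).ncard = 2

/-- A graph all of whose components are single vertices or 2-connected bipartite graphs, in
local form: it has a proper 2-colouring, the neighbours of every vertex `v` stay connected to
each other after deleting `v`, and no vertex has degree one. -/
structure IsBiconnBip (D : SimpleGraph V) : Prop where
  bip : ∃ f : V → Bool, ∀ a b, D.Adj a b → f a ≠ f b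
  cut : ∀ v a b, D.Adj v a → D.Adj v b → (del D {v}).Reachable a b
  deg : ∀ v a, D.Adj v a → ∃ b, b ≠ a ∧ D.Adj v b

lemma del_mono {D E : SimpleGraph V} (h : D ≤ E) (S : Set V) : del D S ≤ del E S :=
  fun _ _ hab => ⟨h hab.1, hab.2⟩

lemma del_empty (D : SimpleGraph V) : del D ∅ = D := by
  ext a b; simp [del]

lemma reachable_del_of_walk {D : SimpleGraph V} {S : Set V} {a b : V} (p : D.Walk a b)
    (h : ∀ x ∈ p.support, x ∉ S) : (del D S).Reachable a b := by
  induction p with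
  | nil => exact Reachable.refl _
  | cons hadj q ih =>
    refine Reachable.trans (Adj.reachable ?_) (ih fun x hx => h x (by simp [hx]))
    exact ⟨hadj, h _ (by simp), h _ (by simp)⟩

/-- A set closed under adjacency contains everything reachable from its members. -/
lemma mem_of_reachable {D : SimpleGraph V} {X : Set V}
    (hX : ∀ a b, a ∈ X → D.Adj a b → b ∈ X) {a b : V} (h : D.Reachable a b) (ha : a ∈ X) :
    b ∈ X := by
  obtain ⟨p⟩ := h
  by_contra hb
  obtain ⟨d, -, h1, h2⟩ := p.exists_boundary_dart X ha hb
  exact h2 (hX _ _ h1 d.adj)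

lemma IsBiconnBip.reachable_del {D : SimpleGraph V} (hD : IsBiconnBip D) {v a b : V}
    (h : D.Reachable a b) (ha : a ≠ v) (hb : b ≠ v) : (del D {v}).Reachable a b := by
  let X : Set V := {x | (x ≠ v → (del D {v}).Reachable a x) ∧
    (x = v → ∃ y, D.Adj v y ∧ (del D {v}).Reachable a y)}
  have hX : ∀ x y, x ∈ X → D.Adj x y → y ∈ X := by
    intro x y hx hxy
    by_cases hxv : x = v
    · subst hxv
      obtain ⟨z, hz, haz⟩ := hx.2 rfl
      exact ⟨fun _ => haz.trans (hD.cut _ _ _ hz hxy), fun h => absurd h hxy.ne'⟩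
    · refine ⟨fun hy => (hx.1 hxv).trans (Adj.reachable ⟨hxy, hxv, hy⟩), ?_⟩
      rintro rfl
      exact ⟨x, hxy.symm, hx.1 hxv⟩
  exact (mem_of_reachable hX h ⟨fun _ => Reachable.refl _, fun h => absurd h ha⟩).1 hb

lemma IsBiconnBip.reachable_del_subsingleton {D : SimpleGraph V} (hD : IsBiconnBip D) {S : Set V}
    (hS : S.Subsingleton) {a b : V} (h : D.Reachable a b) (ha : a ∉ S) (hb : b ∉ S) :
    (del D S).Reachable a b := by
  obtain rfl | ⟨v, rfl⟩ := hS.eq_empty_or_singleton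
  · rwa [del_empty]
  · exact hD.reachable_del h ha hb

/-- In a cubic host graph, adding a cycle keeps the local 2-connectedness. -/
lemma IsBiconnBip.sup_cycle {G D Z : SimpleGraph V} (hcubic : Cubic G) (hD : IsBiconnBip D)
    (hDG : D ≤ G) (hZG : Z ≤ G)
    (hdeg : ∀ v a, Z.Adj v a → ∃ b, b ≠ a ∧ Z.Adj v b)
    (hcyc : ∀ v a b, Z.Adj v a → b ∈ Z.support → b ≠ v → (del Z {v}).Reachable a b)
    (hbip : ∃ f : V → Bool, ∀ a b, (D ⊔ Z).Adj a b → f a ≠ f b) : IsBiconnBip (D ⊔ Z) := by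
  classical
  have hDle := del_mono (le_sup_left : D ≤ D ⊔ Z)
  have hZle := del_mono (le_sup_right : Z ≤ D ⊔ Z)
  have key : ∀ v z a, Z.Adj v z → (D ⊔ Z).Adj v a → (del (D ⊔ Z) {v}).Reachable z a := by
    intro v z a hz ha
    by_cases hZa : Z.Adj v a
    · exact (hcyc v z a hz ⟨v, hZa.symm⟩ hZa.ne').mono (hZle _)
    · have hDa : D.Adj v a := ha.resolve_right hZa
      obtain ⟨z', hz', hvz'⟩ := hdeg v z hz
      obtain ⟨b, hb, hvb⟩ := hD.deg v a hDa
      have hZb : Z.Adj v b := by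
        by_contra hZb
        have hsub : (({a, b, z, z'} : Finset V) : Set V) ⊆ G.neighborSet v := by
          intro x hx
          simp only [Finset.coe_insert, Finset.coe_singleton, Set.mem_insert_iff,
            Set.mem_singleton_iff] at hx
          rcases hx with rfl | rfl | rfl | rfl
          exacts [hDG hDa, hDG hvb, hZG hz, hZG hvz']
        have h3 := hcubic v
        have hle := Set.ncard_le_ncard hsub (Set.finite_of_ncard_ne_zero (by omega))
        have haz : a ≠ z := fun h => hZa (h ▸ hz)
        have haz' : a ≠ z' := fun h => hZa (h ▸ hvz')
        have hbz : b ≠ z := fun h => hZb (h ▸ hz)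
        have hbz' : b ≠ z' := fun h => hZb (h ▸ hvz')
        rw [Set.ncard_coe_finset, h3, Finset.card_insert_of_notMem, Finset.card_insert_of_notMem,
          Finset.card_pair hz'.symm] at hle
        · omega
        · simp [hbz, hbz']
        · simp [hb.symm, haz, haz']
      exact ((hcyc v z b hz ⟨v, hZb.symm⟩ hZb.ne').mono (hZle _)).trans
        ((hD.cut v b a hvb hDa).mono (hDle _))
  refine ⟨hbip, fun v a b ha hb => ?_, ?_⟩
  · by_cases hv : ∃ z, Z.Adj v z
    · obtain ⟨z, hz⟩ := hv
      exact (key v z a hz ha).symm.trans (key v z b hz hb)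
    · have h : ∀ x, (D ⊔ Z).Adj v x → D.Adj v x := fun x hx =>
        hx.resolve_right fun h => hv ⟨x, h⟩
      exact (hD.cut v a b (h a ha) (h b hb)).mono (hDle _)
  · rintro v a (h | h)
    · obtain ⟨b, hb, hvb⟩ := hD.deg v a h
      exact ⟨b, hb, Or.inl hvb⟩
    · obtain ⟨b, hb, hvb⟩ := hdeg v a h
      exact ⟨b, hb, Or.inr hvb⟩

lemma exists_ne_adj_of_isCycle {G : SimpleGraph V} {u : V} {p : G.Walk u u} (hp : p.IsCycle)
    {v a : V} (h : p.toSubgraph.spanningCoe.Adj v a) :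
    ∃ b, b ≠ a ∧ p.toSubgraph.spanningCoe.Adj v b := by
  have h2 := hp.ncard_neighborSet_toSubgraph_eq_two (p.mem_verts_toSubgraph.mp h.fst_mem)
  obtain ⟨b, hb, hba⟩ := Set.exists_ne_of_one_lt_ncard (h2.symm ▸ one_lt_two) a
  exact ⟨b, hba, hb⟩

lemma reachable_del_of_isCycle {G : SimpleGraph V} {u : V} {p : G.Walk u u} (hp : p.IsCycle)
    {v a b : V} (ha : p.toSubgraph.spanningCoe.Adj v a)
    (hb : b ∈ p.toSubgraph.spanningCoe.support) (hbv : b ≠ v) :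
    (del p.toSubgraph.spanningCoe {v}).Reachable a b := by
  classical
  have hv : v ∈ p.support := p.mem_verts_toSubgraph.mp ha.fst_mem
  have ha' : a ∈ p.toSubgraph.verts := ha.snd_mem
  have hb' : b ∈ p.toSubgraph.verts := by
    obtain ⟨c, hc⟩ := hb
    exact hc.fst_mem
  have hav : a ≠ v := ha.ne'
  rw [← p.toSubgraph_rotate hv] at ha' hb' ⊢
  have hq := hp.rotate hv
  generalize p.rotate v hv = q at *
  cases q with
  | nil => simp at hq
  | @cons _ w _ h q =>
    rw [Walk.cons_isCycle_iff] at hq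
    have main : ∀ x ∈ (Walk.cons h q).toSubgraph.verts, x ≠ v →
        (del (Walk.cons h q).toSubgraph.spanningCoe {v}).Reachable w x := by
      intro x hx hxv
      have hxq : x ∈ q.support := by
        rw [Walk.mem_verts_toSubgraph, Walk.support_cons] at hx
        exact (List.mem_cons.mp hx).resolve_left hxv
      have hnot := Walk.endpoint_notMem_support_takeUntil hq.1 hxq hxv.symm
      have hedge : ∀ e ∈ (q.takeUntil x hxq).edges,
          e ∈ (Walk.cons h q).toSubgraph.spanningCoe.edgeSet := by
        intro e he
        have := q.edges_takeUntil_subset_edges hxq he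
        rw [Subgraph.edgeSet_spanningCoe, Walk.mem_edges_toSubgraph]
        simp [this]
      refine reachable_del_of_walk ((q.takeUntil x hxq).transfer _ hedge) ?_
      intro y hy hyv
      rw [Walk.support_transfer] at hy
      exact hnot (hyv ▸ hy)
    exact (main a ha' hav).symm.trans (main b hb' hbv)

lemma finite_setOf_le {H : SimpleGraph V} (hH : H.edgeSet.Finite) : {D | D ≤ H}.Finite := by
  refine Set.Finite.of_finite_image (f := edgeSet) (hH.finite_subsets.subset ?_)
    edgeSet_injective.injOn
  rintro _ ⟨D, hD, rfl⟩
  exact edgeSet_mono hD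

/-- Flipping the colours on a component keeps a 2-colouring proper. -/
lemma ne_of_flip {B : SimpleGraph V} {f : V → Bool} (hf : ∀ a b, B.Adj a b → f a ≠ f b)
    (x : V) (t : Bool) {g : V → Bool}
    (hg : ∀ y, B.Reachable x y → g y = xor (f y) t)
    (hg' : ∀ y, ¬ B.Reachable x y → g y = f y) {a b : V} (hab : B.Adj a b) : g a ≠ g b := by
  have := hf a b hab
  by_cases ha : B.Reachable x a
  · rw [hg a ha, hg b (ha.trans hab.reachable)]
    simpa using this
  · rw [hg' a ha, hg' b fun hb => ha (hb.trans hab.symm.reachable)]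
    exact this

/-- A graph with finitely many edges has a bipartite subgraph above any given one with the same
components. -/
lemma exists_bip_reachable {D H : SimpleGraph V} (hH : H.edgeSet.Finite) (hDH : D ≤ H)
    (hD : ∃ f : V → Bool, ∀ a b, D.Adj a b → f a ≠ f b) :
    ∃ B : SimpleGraph V, D ≤ B ∧ B ≤ H ∧ (∃ f : V → Bool, ∀ a b, B.Adj a b → f a ≠ f b) ∧
      ∀ a b, H.Reachable a b → B.Reachable a b := by
  classical
  let 𝒮 : Set (SimpleGraph V) :=
    {B | B ≤ H ∧ ∃ f : V → Bool, ∀ a b, B.Adj a b → f a ≠ f b}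
  have hfin : 𝒮.Finite := (finite_setOf_le hH).subset fun B hB => hB.1
  obtain ⟨B, hDB, hB⟩ := hfin.exists_le_maximal (show D ∈ 𝒮 from ⟨hDH, hD⟩)
  obtain ⟨hBH, f, hf⟩ := hB.prop
  refine ⟨B, hDB, hBH, ⟨f, hf⟩, fun a b hab => ?_⟩
  refine mem_of_reachable (X := {x | B.Reachable a x}) (fun x y hx hxy => ?_) hab
    (Reachable.refl _)
  by_contra hay
  have hBxy : ¬ B.Reachable x y := fun h => hay (hx.trans h)
  let g : V → Bool := fun z => if B.Reachable x z then xor (f z) (f x == f y) else f z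
  have hmem : B ⊔ edge x y ∈ 𝒮 := by
    refine ⟨sup_le hBH ?_, g, ?_⟩
    · rw [edge_le_iff]
      exact Or.inr hxy
    · rintro c d (hcd | hcd)
      · exact ne_of_flip hf x (f x == f y) (fun z hz => if_pos hz) (fun z hz => if_neg hz) hcd
      · have hgxy : g x ≠ g y := by
          simp only [g, if_pos (Reachable.refl x), if_neg hBxy]
          cases f x <;> cases f y <;> decide
        rw [edge_adj] at hcd
        rcases hcd.1 with ⟨rfl, rfl⟩ | ⟨rfl, rfl⟩
        exacts [hgxy, hgxy.symm]
  have hle : B ⊔ edge x y ≤ B := hB.le_of_ge hmem le_sup_left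
  exact hBxy (hle (Or.inr (by simp [edge_adj, hxy.ne]))).reachable

/-- If `s` and `t` lie in different components of `D` but no two edges separate them in `H`, then
`D` can be enlarged by a cycle of `H`. -/
lemma IsBiconnBip.exists_gt {G D H : SimpleGraph V} (hcubic : Cubic G) (hD : IsBiconnBip D)
    (hDH : D ≤ H) (hHG : H ≤ G) (hH : H.edgeSet.Finite) {s t : V} (hst : ¬ D.Reachable s t)
    (hcut : ∀ e₁ e₂, (H.deleteEdges {e₁, e₂}).Reachable s t) :
    ∃ D', D < D' ∧ D' ≤ H ∧ IsBiconnBip D' := by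
  classical
  -- `H'` drops the edges of `H` leaving the component of `s` in `D`
  let H' : SimpleGraph V :=
    { Adj := fun a b => H.Adj a b ∧ (D.Reachable s a ↔ D.Reachable s b)
      symm := ⟨fun a b h => ⟨h.1.symm, h.2.symm⟩⟩
      loopless := ⟨fun a h => H.loopless.irrefl a h.1⟩ }
  have hH'H : H' ≤ H := fun a b h => h.1
  have hDH' : D ≤ H' := fun a b h =>
    ⟨hDH h, fun h' => h'.trans h.reachable, fun h' => h'.trans h.symm.reachable⟩
  obtain ⟨B, hDB, hBH', ⟨f, hf⟩, hB⟩ :=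
    exists_bip_reachable (hH.subset (edgeSet_mono hH'H)) hDH' hD.bip
  have hout : ∀ x, H'.Reachable t x → ¬ D.Reachable s x := fun x hx =>
    mem_of_reachable (D := H') (X := {x | ¬ D.Reachable s x})
      (fun a b ha hab hb => ha (hab.2.mpr hb)) hx hst
  have hcross : ∀ e₁ e₂, ∃ k c, D.Reachable s k ∧ H'.Reachable t c ∧ H.Adj k c ∧
      s(k, c) ≠ e₁ ∧ s(k, c) ≠ e₂ := by
    intro e₁ e₂
    obtain ⟨p⟩ := (hcut e₁ e₂).symm
    obtain ⟨d, -, hd1, hd2⟩ := p.exists_boundary_dart {x | H'.Reachable t x}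
      (Reachable.refl t) fun h => hout s h (Reachable.refl s)
    have hadj := d.adj
    rw [deleteEdges_adj] at hadj
    have hk : D.Reachable s d.snd := by
      by_contra hk
      exact hd2 (hd1.trans (Adj.reachable ⟨hadj.1, iff_of_false (hout _ hd1) hk⟩))
    have hne : s(d.snd, d.fst) ∉ ({e₁, e₂} : Set (Sym2 V)) := Sym2.eq_swap ▸ hadj.2
    simp only [Set.mem_insert_iff, Set.mem_singleton_iff, not_or] at hne
    exact ⟨d.snd, d.fst, hk, hd1, hadj.1.symm, hne.1, hne.2⟩
  have main : ∀ k₁ c₁ k₂ c₂, D.Reachable s k₁ → H'.Reachable t c₁ → H.Adj k₁ c₁ →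
      D.Reachable s k₂ → H'.Reachable t c₂ → H.Adj k₂ c₂ → s(k₂, c₂) ≠ s(k₁, c₁) →
      (f k₁ == f c₁) = (f k₂ == f c₂) → ∃ D', D < D' ∧ D' ≤ H ∧ IsBiconnBip D' := by
    intro k₁ c₁ k₂ c₂ hk₁ hc₁ h₁ hk₂ hc₂ h₂ hne hsign
    let B' := B ⊔ edge k₁ c₁ ⊔ edge k₂ c₂
    have hB'H : B' ≤ H := sup_le (sup_le (hBH'.trans hH'H) ((edge_le_iff _).mpr (Or.inr h₁)))
      ((edge_le_iff _).mpr (Or.inr h₂))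
    have hnt : ∀ k, D.Reachable s k → ¬ B.Reachable t k := fun k hk h =>
      hout k (h.mono hBH') hk
    let g : V → Bool := fun z => if B.Reachable t z then xor (f z) (f k₁ == f c₁) else f z
    have hg₁ : g k₁ ≠ g c₁ := by
      simp only [g, if_pos (hB t c₁ hc₁), if_neg (hnt k₁ hk₁)]
      cases f k₁ <;> cases f c₁ <;> decide
    have hg₂ : g k₂ ≠ g c₂ := by
      simp only [g, if_pos (hB t c₂ hc₂), if_neg (hnt k₂ hk₂), hsign]
      cases f k₂ <;> cases f c₂ <;> decide
    have hg : ∀ a b, B'.Adj a b → g a ≠ g b := by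
      rintro a b ((hab | hab) | hab)
      · exact ne_of_flip hf t (f k₁ == f c₁) (fun z hz => if_pos hz) (fun z hz => if_neg hz) hab
      · rw [edge_adj] at hab
        rcases hab.1 with ⟨rfl, rfl⟩ | ⟨rfl, rfl⟩
        exacts [hg₁, hg₁.symm]
      · rw [edge_adj] at hab
        rcases hab.1 with ⟨rfl, rfl⟩ | ⟨rfl, rfl⟩
        exacts [hg₂, hg₂.symm]
    have hBdel : B ≤ B'.deleteEdges {s(k₁, c₁)} := by
      intro a b hab
      rw [deleteEdges_adj]
      refine ⟨Or.inl (Or.inl hab), fun h => ?_⟩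
      have hab' : B.Adj k₁ c₁ := by
        rw [← mem_edgeSet, ← Set.mem_singleton_iff.mp h]
        exact hab
      exact hout c₁ hc₁ ((hBH' hab').2.mp hk₁)
    have h₂del : (B'.deleteEdges {s(k₁, c₁)}).Adj k₂ c₂ := by
      rw [deleteEdges_adj]
      exact ⟨Or.inr (by simp [edge_adj, h₂.ne]), hne⟩
    have hreach : (B'.deleteEdges {s(k₁, c₁)}).Reachable k₁ c₁ :=
      (((hk₁.symm.trans hk₂).mono (hDB.trans hBdel)).trans h₂del.reachable).trans
        ((hB _ _ (hc₂.symm.trans hc₁)).mono hBdel)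
    have hadj₁ : B'.Adj k₁ c₁ := Or.inl (Or.inr (by simp [edge_adj, h₁.ne]))
    obtain ⟨u, p, hp, hmem⟩ :=
      adj_and_reachable_delete_edges_iff_exists_cycle.mp ⟨hadj₁, hreach⟩
    have hZB' : p.toSubgraph.spanningCoe ≤ B' := Subgraph.spanningCoe_le _
    have hDB' : D ≤ B' := fun a b h => Or.inl (Or.inl (hDB h))
    refine ⟨D ⊔ p.toSubgraph.spanningCoe, lt_of_le_of_ne le_sup_left fun h => ?_,
      (sup_le hDB' hZB').trans hB'H,
      hD.sup_cycle hcubic (hDH.trans hHG) (hZB'.trans (hB'H.trans hHG))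
        (fun v a h => exists_ne_adj_of_isCycle hp h)
        (fun v a b ha hb hbv => reachable_del_of_isCycle hp ha hb hbv)
        ⟨g, fun a b h => hg a b (sup_le hDB' hZB' h)⟩⟩
    have hDadj : D.Adj k₁ c₁ := by
      rw [h]
      exact Or.inr (Walk.adj_toSubgraph_iff_mem_edges.mpr hmem)
    exact hout c₁ hc₁ (hk₁.trans hDadj.reachable)
  obtain ⟨k₁, c₁, hk₁, hc₁, h₁, -, -⟩ := hcross s(s, s) s(s, s)
  obtain ⟨k₂, c₂, hk₂, hc₂, h₂, h21, -⟩ := hcross s(k₁, c₁) s(k₁, c₁)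
  obtain ⟨k₃, c₃, hk₃, hc₃, h₃, h31, h32⟩ := hcross s(k₁, c₁) s(k₂, c₂)
  by_cases h12 : (f k₁ == f c₁) = (f k₂ == f c₂)
  · exact main k₁ c₁ k₂ c₂ hk₁ hc₁ h₁ hk₂ hc₂ h₂ h21 h12
  by_cases h13 : (f k₁ == f c₁) = (f k₃ == f c₃)
  · exact main k₁ c₁ k₃ c₃ hk₁ hc₁ h₁ hk₃ hc₃ h₃ h31 h13
  · refine main k₂ c₂ k₃ c₃ hk₂ hc₂ h₂ hk₃ hc₃ h₃ h32 ?_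
    revert h12 h13
    generalize (f k₁ == f c₁) = x, (f k₂ == f c₂) = y, (f k₃ == f c₃) = z
    revert x y z
    decide

/-- Deleting two edges from a 3-connected cubic graph leaves a connected graph. -/
lemma reachable_deleteEdges_pair {G : SimpleGraph V} (hcubic : Cubic G) (h3 : IsKConn 3 G)
    (e₁ e₂ : Sym2 V) (s t : V) : (G.deleteEdges {e₁, e₂}).Reachable s t := by
  classical
  have hnbr : ∀ v, ∃ b, (G.deleteEdges {e₁, e₂}).Adj v b := by
    intro v
    by_contra! hno
    have hsub : (fun b => s(v, b)) '' G.neighborSet v ⊆ {e₁, e₂} := by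
      rintro _ ⟨b, hb, rfl⟩
      by_contra hb'
      exact hno b ((deleteEdges_adj ..).mpr ⟨hb, hb'⟩)
    have hle := Set.ncard_le_ncard hsub (Set.toFinite _)
    rw [Set.ncard_image_of_injective _ fun a b h => Sym2.congr_right.mp h, hcubic v] at hle
    have := Set.ncard_insert_le e₁ {e₂}
    rw [Set.ncard_singleton] at this
    omega
  by_contra hst
  let X : Set V := {x | (G.deleteEdges {e₁, e₂}).Reachable s x}
  have hX : ∀ a b, (G.deleteEdges {e₁, e₂}).Adj a b → (a ∈ X ↔ b ∈ X) := fun a b h =>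
    ⟨fun h' => h'.trans h.reachable, fun h' => h'.trans h.symm.reachable⟩
  have hs : s ∈ X := Reachable.refl s
  -- the vertices `x` and `y`, on different sides, meet the two edges if these cross
  obtain ⟨x, hxX, hx⟩ : ∃ x ∈ X, ∀ p q, p ∈ X → q ∉ X → s(p, q) = e₁ → p = x := by
    by_cases h : ∃ p q, p ∈ X ∧ q ∉ X ∧ s(p, q) = e₁
    · obtain ⟨x, q, hx, hq, rfl⟩ := h
      refine ⟨x, hx, fun p q' hp _ h => ?_⟩
      rcases Sym2.eq_iff.mp h with h | h
      · exact h.1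
      · exact absurd (h.1 ▸ hp) hq
    · exact ⟨s, hs, fun p q hp hq he => absurd ⟨p, q, hp, hq, he⟩ h⟩
  obtain ⟨y, hyX, hy⟩ : ∃ y, y ∉ X ∧ ∀ p q, p ∈ X → q ∉ X → s(p, q) = e₂ → q = y := by
    by_cases h : ∃ p q, p ∈ X ∧ q ∉ X ∧ s(p, q) = e₂
    · obtain ⟨p', y, hp', hy, rfl⟩ := h
      refine ⟨y, hy, fun p q _ hq h => ?_⟩
      rcases Sym2.eq_iff.mp h with h | h
      · exact h.2
      · exact absurd (h.2 ▸ hp') hq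
    · exact ⟨t, hst, fun p q hp hq he => absurd ⟨p, q, hp, hq, he⟩ h⟩
  obtain ⟨p, hpx⟩ := hnbr x
  obtain ⟨q, hqy⟩ := hnbr y
  have hpX : p ∈ X := (hX _ _ hpx).mp hxX
  have hqX : q ∉ X := fun h => hyX ((hX _ _ hqy).mpr h)
  have hpS : p ∉ ({x, y} : Set V) := by
    rintro (rfl | rfl)
    exacts [hpx.ne rfl, hyX hpX]
  have hqS : q ∉ ({x, y} : Set V) := by
    rintro (rfl | rfl)
    exacts [hqX hxX, hqy.ne rfl]
  have hcard : ({x, y} : Set V).ncard < 3 := by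
    have := Set.ncard_insert_le x {y}
    rw [Set.ncard_singleton] at this
    omega
  obtain ⟨w⟩ := (h3.2 {x, y} (Set.toFinite _) hcard).preconnected ⟨p, hpS⟩ ⟨q, hqS⟩
  obtain ⟨d, -, hd1, hd2⟩ := w.exists_boundary_dart {z | z.1 ∈ X} hpX hqX
  have hd : s(d.fst.1, d.snd.1) ∈ ({e₁, e₂} : Set (Sym2 V)) := by
    by_contra h
    exact hd2 ((hX _ _ ((deleteEdges_adj ..).mpr ⟨d.adj, h⟩)).mp hd1)
  rcases hd with h | h
  · exact d.fst.2 (Or.inl (hx _ _ hd1 hd2 h))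
  · exact d.snd.2 (Or.inr (hy _ _ hd1 hd2 h))

lemma reachable_of_walk_of_edges {G H : SimpleGraph V} {s t : V} (p : G.Walk s t)
    {e₁ e₂ : Sym2 V} (h : ∀ e ∈ p.edges, e ∈ H.edgeSet ∧ e ≠ e₁ ∧ e ≠ e₂) :
    (H.deleteEdges {e₁, e₂}).Reachable s t := by
  refine ⟨p.transfer _ fun e he => ?_⟩
  rw [edgeSet_deleteEdges]
  obtain ⟨h1, h2, h3⟩ := h e he
  exact ⟨h1, by simp [h2, h3]⟩

/-- If no two edges of `G` separate `s` from `t`, then this is witnessed by finitely many edges. -/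
lemma exists_finite_edges {G : SimpleGraph V} {s t : V}
    (hG : ∀ e₁ e₂, (G.deleteEdges {e₁, e₂}).Reachable s t) :
    ∃ E : Set (Sym2 V), E.Finite ∧ E ⊆ G.edgeSet ∧ ∀ H : SimpleGraph V, E ⊆ H.edgeSet →
      ∀ e₁ e₂, (H.deleteEdges {e₁, e₂}).Reachable s t := by
  have hw : ∀ e₁ e₂, ∃ p : G.Walk s t, ∀ e ∈ p.edges, e ≠ e₁ ∧ e ≠ e₂ := by
    intro e₁ e₂
    obtain ⟨p⟩ := hG e₁ e₂
    refine ⟨p.mapLe (deleteEdges_le _), fun e he => ?_⟩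
    rw [Walk.edges_mapLe_eq_edges] at he
    have := p.edges_subset_edgeSet he
    rw [edgeSet_deleteEdges] at this
    simpa using this.2
  choose p hp using hw
  obtain ⟨w⟩ : G.Reachable s t := (hG s(s, s) s(s, s)).mono (deleteEdges_le _)
  let E : Set (Sym2 V) := {e | e ∈ w.edges} ∪ ⋃ e ∈ {e | e ∈ w.edges},
    ({f | f ∈ (p e e).edges} ∪ ⋃ f ∈ {f | f ∈ (p e e).edges}, {g | g ∈ (p e f).edges})
  have hE₁ : ∀ e ∈ w.edges, e ∈ E := fun e he => Or.inl he
  have hE₂ : ∀ e ∈ w.edges, ∀ f ∈ (p e e).edges, f ∈ E := fun e he f hf =>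
    Or.inr (Set.mem_biUnion (x := e) he (Or.inl hf))
  have hE₃ : ∀ e ∈ w.edges, ∀ f ∈ (p e e).edges, ∀ g ∈ (p e f).edges, g ∈ E :=
    fun e he f hf g hg =>
      Or.inr (Set.mem_biUnion (x := e) he (Or.inr (Set.mem_biUnion (x := f) hf hg)))
  refine ⟨E, ?_, ?_, fun H hH => ?_⟩
  · exact w.edges.finite_toSet.union (w.edges.finite_toSet.biUnion fun e _ =>
      (p e e).edges.finite_toSet.union ((p e e).edges.finite_toSet.biUnion fun f _ =>
        (p e f).edges.finite_toSet))
  · refine Set.union_subset (fun e he => w.edges_subset_edgeSet he) (Set.iUnion₂_subset fun e _ =>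
      Set.union_subset (fun f hf => (p e e).edges_subset_edgeSet hf)
        (Set.iUnion₂_subset fun f _ g hg => (p e f).edges_subset_edgeSet hg))
  · have key : ∀ e f, e ∈ w.edges → (H.deleteEdges {e, f}).Reachable s t := by
      intro e f he
      by_cases hf : f ∈ (p e e).edges
      · exact reachable_of_walk_of_edges (p e f) fun g hg => ⟨hH (hE₃ e he f hf g hg), hp e f g hg⟩
      · exact reachable_of_walk_of_edges (p e e) fun g hg =>
          ⟨hH (hE₂ e he g hg), (hp e e g hg).1, fun h => hf (h ▸ hg)⟩
    intro e₁ e₂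
    by_cases h₁ : e₁ ∈ w.edges
    · exact key e₁ e₂ h₁
    by_cases h₂ : e₂ ∈ w.edges
    · rw [Set.pair_comm]
      exact key e₂ e₁ h₂
    · exact reachable_of_walk_of_edges w fun e he =>
        ⟨hH (hE₁ e he), fun h => h₁ (h ▸ he), fun h => h₂ (h ▸ he)⟩

/-- A graph whose components are single vertices or 2-connected bipartite graphs is locally so. -/
lemma isBiconnBip_of_components {D : SimpleGraph V}
    (hD : ∀ v, {x | D.Reachable v x} = {v} ∨
      (IsKConn 2 (D.induce {x | D.Reachable v x}) ∧
        (D.induce {x | D.Reachable v x}).Colorable 2)) : IsBiconnBip D := by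
  have hdel : ∀ v z x y, IsKConn 2 (D.induce {x | D.Reachable v x}) → D.Reachable v z →
      D.Reachable v x → D.Reachable v y → x ≠ z → y ≠ z → (del D {z}).Reachable x y := by
    intro v z x y hK hz hx hy hxz hyz
    have hconn := hK.2 {⟨z, hz⟩} (Set.toFinite _) (by simp)
    have hxy := hconn.preconnected ⟨⟨x, hx⟩, by simpa using hxz⟩ ⟨⟨y, hy⟩, by simpa using hyz⟩
    let φ : (D.induce {x | D.Reachable v x}).induce {⟨z, hz⟩}ᶜ →g del D {z} :=
      { toFun := fun w => w.1.1
        map_rel' := fun {a b} h =>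
          ⟨h, fun h' => a.2 (Subtype.ext h'), fun h' => b.2 (Subtype.ext h')⟩ }
    exact hxy.map φ
  have hbig : ∀ v a, D.Adj v a → IsKConn 2 (D.induce {x | D.Reachable v x}) := by
    intro v a h
    refine ((hD v).resolve_left fun hv => h.ne' ?_).1
    have : a ∈ {x | D.Reachable v x} := h.reachable
    rwa [hv] at this
  refine ⟨?_, fun v a b ha hb => ?_, fun v a ha => ?_⟩
  · have hcol : D.Colorable 2 := by
      rw [colorable_iff_forall_connectedComponent]
      intro c
      induction c using ConnectedComponent.ind with
      | _ v =>
        have hsupp : (D.connectedComponentMk v).supp = {x | D.Reachable v x} := by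
          ext x
          simp [ConnectedComponent.mem_supp_iff, reachable_comm]
        change (D.induce (D.connectedComponentMk v).supp).Colorable 2
        rw [hsupp]
        rcases hD v with h | h
        · rw [h]
          exact ⟨Coloring.mk (fun _ => 0) fun {a b} hab =>
            absurd (Subsingleton.elim a b) hab.ne⟩
        · exact h.2
    obtain ⟨f⟩ := hcol
    refine ⟨fun x => f x == 0, fun a b hab h => ?_⟩
    have hne := f.valid hab
    change (f a == 0) = (f b == 0) at h
    revert hne h
    generalize f a = i, f b = j
    revert i j
    decide
  · exact hdel v v a b (hbig v a ha) (Reachable.refl v) ha.reachable hb.reachable ha.ne' hb.ne'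
  · have hK := hbig v a ha
    obtain ⟨w, hw, hwv, hwa⟩ : ∃ w, D.Reachable v w ∧ w ≠ v ∧ w ≠ a := by
      by_contra! hno
      have hsub : {x | D.Reachable v x} ⊆ {v, a} := fun x hx => by
        by_cases h : x = v
        · exact Or.inl h
        · exact Or.inr (hno x hx h)
      have h1 := Cardinal.mk_le_mk_of_subset hsub
      have h2 := hK.1.trans_le h1
      rw [← Set.cast_ncard (Set.toFinite _), Set.ncard_pair ha.ne] at h2
      exact lt_irrefl _ h2
    have hreach := hdel v a v w hK ha.reachable (Reachable.refl v) hw ha.ne hwa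
    by_contra! hno
    exact hwv (mem_of_reachable (X := {v}) (fun x y hx hxy => by
      obtain rfl : x = v := hx
      exact absurd hxy.1 (hno y hxy.2.2)) hreach rfl)

/-- The component of a vertex, as a subgraph of a host graph. -/
def componentSubgraph {G D : SimpleGraph V} (h : D ≤ G) (a : V) : G.Subgraph where
  verts := {x | D.Reachable a x}
  Adj x y := D.Adj x y ∧ D.Reachable a x
  adj_sub hxy := h hxy.1
  edge_vert hxy := hxy.2
  symm := ⟨fun _ _ hxy => ⟨hxy.1.symm, hxy.2.trans hxy.1.reachable⟩⟩

lemma IsBiconnBip.isKConn_component {G D : SimpleGraph V} (hD : IsBiconnBip D) (h : D ≤ G)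
    {a b : V} (hab : a ≠ b) (hreach : D.Reachable a b)
    (hfin : (componentSubgraph h a).verts.Finite) :
    IsKConn 2 (componentSubgraph h a).coe := by
  have hcard : 2 < (componentSubgraph h a).verts.ncard := by
    obtain ⟨c, hc⟩ : ∃ c, D.Adj a c := by
      by_contra! hno
      exact hab (mem_of_reachable (X := {a}) (fun x y hx hxy => by
        obtain rfl : x = a := hx
        exact absurd hxy (hno y)) hreach rfl).symm
    obtain ⟨d, hdc, hd⟩ := hD.deg a c hc
    rw [Set.two_lt_ncard_iff hfin]
    exact ⟨a, c, d, Reachable.refl a, hc.reachable, hd.reachable, hc.ne, hd.ne, hdc.symm⟩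
  refine ⟨?_, fun X hX hX2 => ?_⟩
  · rw [← Set.cast_ncard hfin]
    exact_mod_cast hcard
  have hsub : (Subtype.val '' X).Subsingleton := by
    have : X.Subsingleton := by
      rw [← Set.encard_le_one_iff_subsingleton, ← hX.cast_ncard_eq]
      exact_mod_cast Nat.lt_succ_iff.mp hX2
    exact this.image _
  have hne : Nonempty (Xᶜ : Set (componentSubgraph h a).verts) := by
    by_contra hno
    have hall : (componentSubgraph h a).verts ⊆ Subtype.val '' X := fun x hx => by
      by_contra hxX
      exact hno ⟨⟨⟨x, hx⟩, fun hx' => hxX ⟨_, hx', rfl⟩⟩⟩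
    have h1 := Set.ncard_le_ncard hall (hX.image _)
    have h2 := Set.ncard_image_le (f := Subtype.val) hX
    omega
  refine connected_iff _ |>.mpr ⟨?_, hne⟩
  rintro ⟨⟨x, hx⟩, hxX⟩ ⟨⟨y, hy⟩, hyX⟩
  have hval : ∀ z (hz : z ∈ (componentSubgraph h a).verts),
      z ∉ Subtype.val '' X ↔ ⟨z, hz⟩ ∉ X := by
    intro z hz
    simp [hz]
  have hxy : (del D (Subtype.val '' X)).Reachable x y :=
    hD.reachable_del_subsingleton hsub (Reachable.trans (Reachable.symm hx) hy)
      ((hval x hx).mpr hxX) ((hval y hy).mpr hyX)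
  let Y : Set V := {z | ∃ w : (Xᶜ : Set (componentSubgraph h a).verts), w.1.1 = z ∧
    ((componentSubgraph h a).coe.induce Xᶜ).Reachable ⟨⟨x, hx⟩, hxX⟩ w}
  have hY : ∀ u v, u ∈ Y → (del D (Subtype.val '' X)).Adj u v → v ∈ Y := by
    rintro _ v ⟨⟨⟨u, hu⟩, huX⟩, rfl, hr⟩ huv
    have hv : v ∈ (componentSubgraph h a).verts := Reachable.trans hu huv.1.reachable
    exact ⟨⟨⟨v, hv⟩, (hval v hv).mp huv.2.2⟩, rfl, hr.trans (Adj.reachable ⟨huv.1, hu⟩)⟩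
  obtain ⟨⟨⟨_, _⟩, _⟩, rfl, hr⟩ := mem_of_reachable hY hxy ⟨_, rfl, Reachable.refl _⟩
  exact hr

/-- In a 3-connected cubic graph `G`, if `D` is a finite subgraph each of
whose components is an isolated vertex or a 2-connected bipartite graph, then `G` has a
finite 2-connected bipartite subgraph `F` with `D ≤ F`. -/
theorem exists_bipartite_containing {V : Type u} (G : SimpleGraph V)
    (hcubic : Cubic G) (h3 : IsKConn 3 G)
    (D : G.Subgraph) (hDfin : D.verts.Finite)
    (hDcomp : ∀ v ∈ D.verts,
      {x | D.spanningCoe.Reachable v x} = {v} ∨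
        (IsKConn 2 (D.spanningCoe.induce {x | D.spanningCoe.Reachable v x}) ∧
          (D.spanningCoe.induce {x | D.spanningCoe.Reachable v x}).Colorable 2)) :
    ∃ F : G.Subgraph, F.verts.Finite ∧ D ≤ F ∧ IsKConn 2 F.coe ∧ F.coe.Colorable 2 := by
  classical
  have hcut := reachable_deleteEdges_pair hcubic h3
  have hD : IsBiconnBip D.spanningCoe := by
    refine isBiconnBip_of_components fun v => ?_
    by_cases hv : v ∈ D.verts
    · exact hDcomp v hv
    · refine Or.inl (Set.eq_singleton_iff_unique_mem.mpr ⟨Reachable.refl v, fun x hx => ?_⟩)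
      refine mem_of_reachable (X := {v}) (fun y z hy hyz => ?_) hx rfl
      obtain rfl : y = v := hy
      exact absurd (D.edge_vert hyz) hv
  obtain ⟨a, b, hab⟩ : ∃ a b : V, a ≠ b := by
    have : Nontrivial V := by
      rw [← Cardinal.one_lt_iff_nontrivial]
      exact lt_trans (by norm_num) h3.1
    exact exists_pair_ne V
  let T : Set V := insert a (insert b D.verts)
  have hT : T.Finite := (hDfin.insert b).insert a
  choose E hEfin hEG hE using fun s t => exists_finite_edges fun e₁ e₂ => hcut e₁ e₂ s t
  let H : SimpleGraph V := D.spanningCoe ⊔ fromEdgeSet (⋃ s ∈ T, ⋃ t ∈ T, E s t)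
  have hHG : H ≤ G := by
    refine sup_le D.spanningCoe_le fun x y hxy => ?_
    have := ((fromEdgeSet_adj _).mp hxy).1
    simp only [Set.mem_iUnion] at this
    obtain ⟨s, -, t, -, h⟩ := this
    exact hEG s t h
  have hHfin : H.edgeSet.Finite := by
    rw [edgeSet_sup, edgeSet_fromEdgeSet]
    refine Set.Finite.union (((hDfin.prod hDfin).image fun p => s(p.1, p.2)).subset ?_)
      ((hT.biUnion fun s _ => hT.biUnion fun t _ => hEfin s t).sdiff)
    intro e he
    induction e with
    | _ x y =>
      have hxy : D.Adj x y := he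
      exact ⟨(x, y), ⟨hxy.fst_mem, hxy.snd_mem⟩, rfl⟩
  have hHcut : ∀ s ∈ T, ∀ t ∈ T, ∀ e₁ e₂, (H.deleteEdges {e₁, e₂}).Reachable s t := by
    intro s hs t ht
    refine hE s t H fun e he => ?_
    rw [edgeSet_sup, edgeSet_fromEdgeSet]
    exact Or.inr ⟨Set.mem_biUnion hs (Set.mem_biUnion ht he),
      G.not_isDiag_of_mem_edgeSet (hEG s t he)⟩
  obtain ⟨M, hDM, hM⟩ := ((finite_setOf_le hHfin).subset fun M (hM : M ≤ H ∧ IsBiconnBip M) =>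
    hM.1).exists_le_maximal ⟨le_sup_left, hD⟩
  have hMH : M ≤ H := hM.prop.1
  have hreach : ∀ x ∈ T, M.Reachable a x := by
    intro x hx
    by_contra hax
    obtain ⟨M', hlt, hM'H, hM'⟩ := hM.prop.2.exists_gt hcubic hMH hHG hHfin hax
      (hHcut a (Set.mem_insert ..) x hx)
    exact hlt.not_ge (hM.le_of_ge ⟨hM'H, hM'⟩ hlt.le)
  have hFfin : (componentSubgraph (hMH.trans hHG) a).verts.Finite := by
    have hfin : (insert a (⋃ e ∈ H.edgeSet, {x | x ∈ e})).Finite :=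
      (hHfin.biUnion fun e _ => by
        induction e with
        | _ x y => exact (Set.toFinite {x, y}).subset fun z hz => by simpa using hz).insert a
    refine hfin.subset fun x hx => mem_of_reachable (D := M) (fun y z _ hyz => ?_) hx
      (Set.mem_insert ..)
    exact Or.inr (Set.mem_biUnion (x := s(y, z)) (hMH hyz) (Sym2.mem_mk_right y z))
  refine ⟨componentSubgraph (hMH.trans hHG) a, hFfin, ⟨fun x hx => hreach x ?_, fun x y hxy =>
    ⟨hDM hxy, hreach x ?_⟩⟩, hM.prop.2.isKConn_component (hMH.trans hHG) hab
      (hreach b (Or.inr (Or.inl rfl))) hFfin, ?_⟩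
  · exact Or.inr (Or.inr hx)
  · exact Or.inr (Or.inr hxy.fst_mem)
  · obtain ⟨f, hf⟩ := hM.prop.2.bip
    have c : (componentSubgraph (hMH.trans hHG) a).coe.Coloring Bool :=
      Coloring.mk (fun x => f x.1) fun {x y} hxy => hf _ _ hxy.1
    simpa using c.colorable

end IGraph
end

section
/- Let G be an infinite locally finite connected graph and let (F_i)_{i=1}^∞ be a sequence of finite connected subgraphs of G such that for all i ≥ 1: F_i is a subgraph of F_{i+1} and N_G(V(F_i)) ⊆ V(F_{i+1}). Suppose moreover that for every i and every component H of G − F_{i+1}, there is a component D of F_{i+1} − F_i with N_G(V(H)) ⊆ V(D). Then F = ⋃_{i=1}^∞ F_i is a faithful spanning subgraph of G. -/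
namespace IGraph

open SimpleGraph

universe u w

variable {V : Type u} {W : Type w}

lemma del_mono_s7 {H K : SimpleGraph V} {S T : Set V} (hHK : H ≤ K) (hST : S ⊆ T) :
    del H T ≤ del K S :=
  fun _ _ h => ⟨hHK h.1, fun hs => h.2.1 (hST hs), fun hs => h.2.2 (hST hs)⟩

lemma notMem_of_reachable_del {H : SimpleGraph V} {S : Set V} {a b : V}
    (h : (del H S).Reachable a b) (ha : a ∉ S) : b ∉ S := by
  obtain ⟨p⟩ := h
  induction p with
  | nil => exact ha
  | cons h _ ih => exact ih h.2.2

/-- A walk starting outside `S` and ending in `S` enters `S` for the first time somewhere. -/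
lemma exists_adj_mem_of_reachable {H : SimpleGraph V} {S : Set V} {a b : V}
    (h : H.Reachable a b) (ha : a ∉ S) (hb : b ∈ S) :
    ∃ u y, (del H S).Reachable a u ∧ H.Adj u y ∧ y ∈ S := by
  obtain ⟨p⟩ := h
  induction p with
  | nil => exact absurd hb ha
  | @cons a c b h _ ih =>
    by_cases hcS : c ∈ S
    · exact ⟨a, c, Reachable.refl _, h, hcS⟩
    · obtain ⟨u, y, hu, hy⟩ := ih hcS hb
      have hac : (del H S).Adj a c := ⟨h, ha, hcS⟩
      exact ⟨u, y, hac.reachable.trans hu, hy⟩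

lemma IsRay.exists_tail_notMem {G : SimpleGraph V} {R : ℕ → V} (hR : IsRay G R)
    {S : Set V} (hS : S.Finite) : ∃ m, ∀ j, m ≤ j → R j ∉ S := by
  obtain ⟨b, hb⟩ := (hS.preimage hR.1.injOn).bddAbove
  exact ⟨b + 1, fun j hj hjS => by have := hb hjS; omega⟩

lemma IsRay.reachable_del {G : SimpleGraph V} {R : ℕ → V} (hR : IsRay G R) {S : Set V}
    {m n : ℕ} (hm : ∀ j, m ≤ j → R j ∉ S) (hn : ∀ j, n ≤ j → R j ∉ S) :
    (del G S).Reachable (R m) (R n) := by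
  wlog hmn : m ≤ n generalizing m n
  · exact (this hn hm (by omega)).symm
  induction n, hmn using Nat.le_induction with
  | base => exact Reachable.refl _
  | succ k hk ih =>
    have hadj : (del G S).Adj (R k) (R (k + 1)) := ⟨hR.2 k, hm k hk, hm _ (by omega)⟩
    exact (ih fun j hj => hm j (by omega)).trans hadj.reachable

/-- An infinite lazy walk visiting every vertex only finitely often contains a ray, obtained by
following the last visits. -/
lemma exists_strictMono_isRay {H : SimpleGraph V} {W : ℕ → V}
    (hW : ∀ n, W n = W (n + 1) ∨ H.Adj (W n) (W (n + 1)))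
    (hfin : ∀ v, {n | W n = v}.Finite) :
    ∃ t : ℕ → ℕ, StrictMono t ∧ IsRay H (W ∘ t) := by
  have hlast : ∀ n, ∃ l, n ≤ l ∧ W l = W n ∧ ∀ k, W k = W n → k ≤ l := by
    intro n
    obtain ⟨l, hl, hmax⟩ := Set.exists_max_image _ id (hfin (W n)) ⟨n, rfl⟩
    exact ⟨l, hmax n rfl, hl, hmax⟩
  choose L hle hval hmax using hlast
  let t : ℕ → ℕ := fun k => Nat.rec (L 0) (fun _ s => L (s + 1)) k
  have hsucc : ∀ k, t (k + 1) = L (t k + 1) := fun _ => rfl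
  have hlt : ∀ k j, W j = W (t k) → j ≤ t k := by
    rintro (_ | k) j hj
    · exact hmax 0 j (hj.trans (hval 0))
    · rw [hsucc] at hj ⊢
      exact hmax _ j (hj.trans (hval _))
  have ht : StrictMono t := strictMono_nat_of_lt_succ fun k => by
    have := hle (t k + 1)
    rw [hsucc]
    omega
  refine ⟨t, ht, fun a b hab => ?_, fun k => ?_⟩
  · exact ht.injective (le_antisymm (hlt b _ hab) (hlt a _ hab.symm))
  · have hnext : W (t (k + 1)) = W (t k + 1) := by rw [hsucc, hval]
    simp only [Function.comp_apply, hnext]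
    refine (hW (t k)).resolve_left fun h => ?_
    have := hlt k _ h.symm
    omega

/-- Walks `p i` with matching endpoints can be concatenated to an infinite lazy walk whose
vertices from some time on all come from the walks `p l` with `l ≥ i`. -/
lemma exists_lazy_concat {H : SimpleGraph V} {a : ℕ → V}
    (p : ∀ i, H.Walk (a i) (a (i + 1))) :
    ∃ W : ℕ → V, (∀ n, W n = W (n + 1) ∨ H.Adj (W n) (W (n + 1))) ∧
      ∀ i, ∃ T, ∀ n, T ≤ n → ∃ l, i ≤ l ∧ W n ∈ (p l).support := by
  let step : ℕ × ℕ → ℕ × ℕ := fun s =>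
    if s.2 < (p s.1).length then (s.1, s.2 + 1) else (s.1 + 1, 0)
  let σ : ℕ → ℕ × ℕ := fun n => step^[n] (0, 0)
  have hσ : ∀ n, σ (n + 1) = step (σ n) := fun n => Function.iterate_succ_apply' _ _ _
  have hmono : Monotone fun n => (σ n).1 := monotone_nat_of_le_succ fun n => by
    rw [hσ]
    dsimp only [step]
    split_ifs <;> simp
  have hreach : ∀ i, ∃ T, σ T = (i, 0) := by
    intro i
    induction i with
    | zero => exact ⟨0, rfl⟩
    | succ i ih =>
      obtain ⟨T, hT⟩ := ih
      have hk : ∀ k, k ≤ (p i).length → σ (T + k) = (i, k) := by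
        intro k
        induction k with
        | zero => exact fun _ => hT
        | succ k ihk =>
          intro hk
          rw [← Nat.add_assoc, hσ, ihk (by omega)]
          exact if_pos hk
      refine ⟨T + (p i).length + 1, ?_⟩
      rw [hσ, hk _ le_rfl]
      exact if_neg (lt_irrefl _)
  refine ⟨fun n => (p (σ n).1).getVert (σ n).2, fun n => ?_, fun i => ?_⟩
  · dsimp only
    rw [hσ]
    by_cases h : (σ n).2 < (p (σ n).1).length
    · have hs : step (σ n) = ((σ n).1, (σ n).2 + 1) := if_pos h
      rw [hs]
      exact Or.inr ((p (σ n).1).adj_getVert_succ h)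
    · have hs : step (σ n) = ((σ n).1 + 1, 0) := if_neg h
      rw [hs]
      left
      rw [Walk.getVert_of_length_le _ (not_lt.mp h), Walk.getVert_zero]
  · obtain ⟨T, hT⟩ := hreach i
    refine ⟨T, fun n hn => ⟨(σ n).1, ?_, Walk.getVert_mem_support _ _⟩⟩
    have := hmono hn
    simpa only [hT] using this

/-- If `N_G(X i) ⊆ X (i + 1)` for a sequence of vertex sets of a connected graph, the
first of which is nonempty, then every vertex is in some `X i`. -/
lemma exists_mem_of_nSet_subset {G : SimpleGraph V} (hconn : G.Connected) {X : ℕ → Set V}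
    (hN : ∀ i, NSet G (X i) ⊆ X (i + 1)) (h0 : (X 0).Nonempty) (v : V) : ∃ i, v ∈ X i := by
  obtain ⟨x, hx⟩ := h0
  obtain ⟨p⟩ := hconn.preconnected v x
  induction p with
  | nil => exact ⟨0, hx⟩
  | @cons a b _ h _ ih =>
    obtain ⟨i, hi⟩ := ih hx
    by_cases ha : a ∈ X i
    · exact ⟨i, ha⟩
    · exact ⟨i + 1, hN i ⟨ha, b, hi, h.symm⟩⟩

lemma exists_subset_of_finite {X : ℕ → Set V} (hX : Monotone X) (hcov : ∀ v, ∃ i, v ∈ X i)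
    {S : Set V} (hS : S.Finite) : ∃ i, S ⊆ X i := by
  choose f hf using hcov
  obtain ⟨b, hb⟩ := (hS.image f).bddAbove
  exact ⟨b, fun v hv => hX (hb ⟨v, hv, rfl⟩) (hf v)⟩

/-- If any two vertices joined in `G − X (i + 1)` are joined in `U − X i` as well, for an
exhaustion `X` of the vertices by finite sets, then the subgraph `U` is faithful to `G`. -/
lemma faithful_of_reachable_del {G U : SimpleGraph V} (hU : U ≤ G) {X : ℕ → Set V}
    (hX : Monotone X) (hfin : ∀ i, (X i).Finite) (hcov : ∀ v, ∃ i, v ∈ X i)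
    (hkey : ∀ i v w, v ∉ X (i + 1) → (del G (X (i + 1))).Reachable v w →
      (del U (X i)).Reachable v w) : Faithful U G := by
  refine ⟨fun R hR => ?_, fun R₁ R₂ _ _ => ⟨fun h S hS => ?_, fun h S hS => ?_⟩⟩
  · choose m hm using fun i => hR.exists_tail_notMem (hfin (i + 1))
    have hseg : ∀ i l, i ≤ l → (del U (X i)).Reachable (R (m i)) (R (m l)) := fun i l hil =>
      hkey i _ _ (hm i _ le_rfl) (hR.reachable_del (hm i)
        fun j hj h => hm l j hj (hX (by omega) h))
    let q := fun i => (hseg i (i + 1) (by omega)).some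
    obtain ⟨W, hW, hT⟩ := exists_lazy_concat
      (fun i => (q i).mapLe (fun _ _ h => h.1 : del U (X i) ≤ U))
    choose T hT using hT
    have hWreach : ∀ i n, T i ≤ n → (del U (X i)).Reachable (R (m i)) (W n) := by
      intro i n hn
      obtain ⟨l, hil, hl⟩ := hT i n hn
      rw [Walk.support_mapLe_eq_support] at hl
      classical
      have hr : (del U (X l)).Reachable (R (m l)) (W n) := ⟨(q l).takeUntil _ hl⟩
      exact (hseg i l hil).trans (hr.mono (del_mono_s7 le_rfl (hX hil)))
    have hWnot : ∀ i n, T i ≤ n → W n ∉ X i := fun i n hn =>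
      notMem_of_reachable_del (hWreach i n hn) fun h => hm i _ le_rfl (hX (by omega) h)
    have hWfin : ∀ v, {n | W n = v}.Finite := by
      intro v
      obtain ⟨i, hi⟩ := hcov v
      refine (Set.finite_lt_nat (T i)).subset fun n hn => ?_
      by_contra hlt
      exact hWnot i n (not_lt.mp hlt) (by rwa [show W n = v from hn])
    obtain ⟨t, ht, hray⟩ := exists_strictMono_isRay hW hWfin
    refine ⟨W ∘ t, hray, fun S hS => ?_⟩
    obtain ⟨i, hi⟩ := exists_subset_of_finite hX hcov hS
    refine ⟨m i, T i, fun j hj h => hm i j hj (hX (by omega) (hi h)),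
      fun j hj h => hWnot i (t j) (hj.trans (ht.id_le j)) (hi h), ?_⟩
    exact (hWreach i _ (ht.id_le _)).mono (del_mono_s7 hU hi)
  · obtain ⟨m, n, hm, hn, hr⟩ := h S hS
    exact ⟨m, n, hm, hn, hr.mono (del_mono_s7 hU le_rfl)⟩
  · obtain ⟨i, hi⟩ := exists_subset_of_finite hX hcov hS
    obtain ⟨m, n, hm, hn, hr⟩ := h _ (hfin (i + 1))
    have hSX : S ⊆ X (i + 1) := hi.trans (hX (by omega))
    exact ⟨m, n, fun j hj h => hm j hj (hSX h), fun j hj h => hn j hj (hSX h),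
      (hkey i _ _ (hm m le_rfl) hr).mono (del_mono_s7 le_rfl hi)⟩

/-- If the neighborhood of the component of `v` in `G − T` lies in the component of `d` in
`K − S`, where `S ⊆ T` and `K ≤ U ≤ G` with `U` connected, then `v` is joined to `d` in
`U − S`. -/
lemma reachable_del_of_nSet_subset {G U K : SimpleGraph V} (hU : U ≤ G) (hK : K ≤ U)
    (hconn : U.Preconnected) {S T : Set V} (hST : S ⊆ T) {v d : V} (hv : v ∉ T) (hdT : d ∈ T)
    (hdS : d ∉ S) (hsub : NSet G (compOf G T v) ⊆ compOf K S d) :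
    (del U S).Reachable v d := by
  obtain ⟨u, y, hu, huy, hy⟩ := exists_adj_mem_of_reachable (hconn v d) hv hdT
  have huG : (del G T).Reachable v u := hu.mono (del_mono_s7 hU le_rfl)
  have hyd : (del K S).Reachable d y :=
    hsub ⟨fun h => notMem_of_reachable_del h hv hy, u, huG, hU huy⟩
  have hadj : (del U S).Adj u y :=
    ⟨huy, fun h => notMem_of_reachable_del hu hv (hST h), notMem_of_reachable_del hyd hdS⟩
  exact ((hu.mono (del_mono_s7 le_rfl hST)).trans hadj.reachable).trans
    (hyd.mono (del_mono_s7 hK le_rfl)).symm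

/-- If `(F i)` is an increasing sequence of finite connected subgraphs of
`G` with `N_G(V(F i)) ⊆ V(F (i+1))`, and every component `H` of `G − F (i+1)` has
`N_G(V(H))` inside the vertex set of one component of `F (i+1) − F i`, then
`⋃ F i` is a faithful spanning subgraph of `G`. (The sequence is indexed so that `F 0`
plays the role of `F₁`.) -/
theorem union_faithful_spanning {V : Type u} (G : SimpleGraph V)
    (hinf : Infinite V) (hlf : LocFin G) (hconn : G.Connected)
    (F : ℕ → G.Subgraph)
    (hfin : ∀ i, (F i).verts.Finite) (hc : ∀ i, (F i).Connected)
    (hmono : ∀ i, F i ≤ F (i + 1))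
    (hN : ∀ i, NSet G (F i).verts ⊆ (F (i + 1)).verts)
    (hcomp : ∀ i, ∀ v, v ∉ (F (i + 1)).verts →
      ∃ d, d ∈ (F (i + 1)).verts ∧ d ∉ (F i).verts ∧
        NSet G (compOf G (F (i + 1)).verts v) ⊆
          compOf (F (i + 1)).spanningCoe (F i).verts d) :
    (⨆ i, F i : G.Subgraph).IsSpanning ∧
      Faithful (⨆ i, F i : G.Subgraph).spanningCoe G := by
  have hF : Monotone F := monotone_nat_of_le_succ hmono
  have hX : Monotone fun i => (F i).verts := fun _ _ h => (hF h).1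
  have hcov : ∀ v, ∃ i, v ∈ (F i).verts :=
    exists_mem_of_nSet_subset hconn hN (hc 0).nonempty
  have hle : ∀ i, (F i).spanningCoe ≤ (⨆ i, F i : G.Subgraph).spanningCoe := fun i =>
    Subgraph.spanningCoe_le_of_le (le_iSup F i)
  have hU : (⨆ i, F i : G.Subgraph).spanningCoe ≤ G := Subgraph.spanningCoe_le _
  have hpre : (⨆ i, F i : G.Subgraph).spanningCoe.Preconnected := by
    intro a b
    obtain ⟨i, hi⟩ := hcov a
    obtain ⟨j, hj⟩ := hcov b
    have hr := (hc (max i j)).preconnected.coe ⟨a, hX (le_max_left i j) hi⟩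
      ⟨b, hX (le_max_right i j) hj⟩
    have hr' : (F (max i j)).spanningCoe.Reachable a b :=
      hr.map ⟨Subtype.val, fun h => h⟩
    exact hr'.mono (hle _)
  refine ⟨fun v => ?_, faithful_of_reachable_del hU hX hfin hcov fun i v w hv hvw => ?_⟩
  · obtain ⟨i, hi⟩ := hcov v
    exact (le_iSup F i).1 hi
  · obtain ⟨d, hdT, hdS, hsub⟩ := hcomp i v hv
    have hw := notMem_of_reachable_del hvw hv
    have hvw' : compOf G (F (i + 1)).verts w = compOf G (F (i + 1)).verts v :=
      Set.ext fun x => ⟨hvw.trans, hvw.symm.trans⟩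
    exact (reachable_del_of_nSet_subset hU (hle _) hpre (hmono i).1 hv hdT hdS hsub).trans
      (reachable_del_of_nSet_subset hU (hle _) hpre (hmono i).1 hw hdT hdS
        (hvw' ▸ hsub)).symm

end IGraph
end
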